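/- arXiv:1105.0697 — 3 statements merged into one kernel-verified Lean document; each statement's English description precedes it below -/
import Mathlib

section
/- Let n ≥ 1, let K and I be finite sets, let σ : K → Fin n, and for each i ∈ I let P_i be a nonempty finite set with τ_i : P_i → Fin n. Suppose each φ_k : ℝ → ℝ (k ∈ K) is concave on [0, ∞), and each h_{i,j} : ℝ → ℝ (i ∈ I, j ∈ P_i) is concave and nonnegative on [0, ∞). Let D be a convex subset of the nonnegative orthant of ℝⁿ on which Σ_{j ∈ P_i} h_{i,j}(A_{τ_i(j)}) > 0 for every i ∈ I. Then the function L : ℝⁿ → ℝ given by L(A) = Σ_{k ∈ K} φ_k(A_{σ(k)}) + Σ_{i ∈ I} log(Σ_{j ∈ P_i} h_{i,j}(A_{τ_i(j)})) is concave on D; equivalently, -L is convex on D. -/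
open Finset

/-- General form of Theorem 1: a sum of concave log-survival terms, each depending on a
single coordinate of the rate vector, plus logarithms of sums of concave nonnegative
hazard terms, is concave on any convex subset `D` of the nonnegative orthant on which the
hazard sums are positive; equivalently the negative log-likelihood is convex on `D`. -/
theorem loglikelihood_concave_general {n : ℕ} (hn : 1 ≤ n)
    {K I : Type*} [Fintype K] [Fintype I]
    (P : I → Type*) [∀ i, Fintype (P i)] [∀ i, Nonempty (P i)]
    (σ : K → Fin n) (τ : ∀ i, P i → Fin n)
    (φ : K → ℝ → ℝ) (h : ∀ i, P i → ℝ → ℝ)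
    (hφ : ∀ k, ConcaveOn ℝ (Set.Ici (0 : ℝ)) (φ k))
    (hconc : ∀ i (j : P i), ConcaveOn ℝ (Set.Ici (0 : ℝ)) (h i j))
    (hnn : ∀ i (j : P i), ∀ x ∈ Set.Ici (0 : ℝ), 0 ≤ h i j x)
    (D : Set (Fin n → ℝ)) (hD : Convex ℝ D)
    (hDsub : ∀ A ∈ D, ∀ l, 0 ≤ A l)
    (hpos : ∀ A ∈ D, ∀ i : I, 0 < ∑ j : P i, h i j (A (τ i j))) :
    ConcaveOn ℝ D (fun A : Fin n → ℝ =>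
        ∑ k : K, φ k (A (σ k)) + ∑ i : I, Real.log (∑ j : P i, h i j (A (τ i j)))) ∧
    ConvexOn ℝ D (fun A : Fin n → ℝ =>
        -(∑ k : K, φ k (A (σ k)) + ∑ i : I, Real.log (∑ j : P i, h i j (A (τ i j))))) := by
  have key : ConcaveOn ℝ D (fun A : Fin n → ℝ =>
        ∑ k : K, φ k (A (σ k)) + ∑ i : I, Real.log (∑ j : P i, h i j (A (τ i j)))) := by
    refine ⟨hD, ?_⟩
    intro x hx y hy a b ha hb hab
    have hz := hD hx hy ha hb hab
    have h1 : ∑ k : K, (a * φ k (x (σ k)) + b * φ k (y (σ k)))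
        ≤ ∑ k : K, φ k ((a • x + b • y) (σ k)) :=
      Finset.sum_le_sum fun k _ => (hφ k).2 (hDsub x hx _) (hDsub y hy _) ha hb hab
    have h2 : ∑ i : I, (a * Real.log (∑ j : P i, h i j (x (τ i j)))
          + b * Real.log (∑ j : P i, h i j (y (τ i j))))
        ≤ ∑ i : I, Real.log (∑ j : P i, h i j ((a • x + b • y) (τ i j))) := by
      refine Finset.sum_le_sum fun i _ => ?_
      have hxi := hpos x hx i
      have hyi := hpos y hy i
      have h3 := strictConcaveOn_log_Ioi.concaveOn.2 hxi hyi ha hb hab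
      have h4 : ∑ j : P i, (a * h i j (x (τ i j)) + b * h i j (y (τ i j)))
          ≤ ∑ j : P i, h i j ((a • x + b • y) (τ i j)) :=
        Finset.sum_le_sum fun j _ => (hconc i j).2 (hDsub x hx _) (hDsub y hy _) ha hb hab
      rw [Finset.sum_add_distrib, ← Finset.mul_sum, ← Finset.mul_sum] at h4
      have h5 := (convex_Ioi (0 : ℝ)) hxi hyi ha hb hab
      simp only [smul_eq_mul, Set.mem_Ioi] at h3 h5
      exact h3.trans (Real.log_le_log h5 h4)
    rw [Finset.sum_add_distrib, ← Finset.mul_sum, ← Finset.mul_sum] at h1 h2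
    simp only [smul_eq_mul]
    linarith
  exact ⟨key, key.neg⟩
end

section
/- Let n ≥ 1 and let w : Fin n → ℝ with w_j > 0 for all j. Define f(α) = Σ_j w_j·α_j - log(Σ_j α_j) on the domain D = {α ∈ ℝⁿ : α_j ≥ 0 for all j, and Σ_j α_j > 0}. Then for every M ∈ ℝ, the sublevel set {α ∈ D : f(α) ≤ M} is compact. -/
open Finset

/-- Sublevel sets of the single-node exponential-model negative log-likelihood
`f α = ∑ j, w j * α j - log (∑ j, α j)` on the domain
`{α | ∀ j, 0 ≤ α j, and 0 < ∑ j, α j}` are compact. -/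
theorem netrate_sublevel_compact {n : ℕ} (hn : 1 ≤ n) (w : Fin n → ℝ)
    (hw : ∀ j, 0 < w j) (M : ℝ) :
    IsCompact {α : Fin n → ℝ | ((∀ j, 0 ≤ α j) ∧ 0 < ∑ j, α j) ∧
      (∑ j, w j * α j) - Real.log (∑ j, α j) ≤ M} := by
  have : Nonempty (Fin n) := ⟨⟨0, hn⟩⟩
  obtain ⟨j₀, hj₀⟩ := Finite.exists_min w
  have hc : 0 < w j₀ := hw j₀
  have heq : {α : Fin n → ℝ | ((∀ j, 0 ≤ α j) ∧ 0 < ∑ j, α j) ∧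
      (∑ j, w j * α j) - Real.log (∑ j, α j) ≤ M} =
      {α : Fin n → ℝ | ∀ j, 0 ≤ α j} ∩
      {α : Fin n → ℝ | Real.exp ((∑ j, w j * α j) - M) ≤ ∑ j, α j} := by
    ext α
    simp only [Set.mem_setOf_eq, Set.mem_inter_iff]
    constructor
    · rintro ⟨⟨h0, hS⟩, h⟩
      exact ⟨h0, (Real.le_log_iff_exp_le hS).1 (by linarith)⟩
    · rintro ⟨h0, h⟩
      have hS := (Real.exp_pos _).trans_le h
      have := (Real.le_log_iff_exp_le hS).2 h
      exact ⟨⟨h0, hS⟩, by linarith⟩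
  have hcl : IsClosed {α : Fin n → ℝ | ((∀ j, 0 ≤ α j) ∧ 0 < ∑ j, α j) ∧
      (∑ j, w j * α j) - Real.log (∑ j, α j) ≤ M} := by
    rw [heq]
    refine IsClosed.inter ?_ (isClosed_le (by fun_prop) (by fun_prop))
    simp only [Set.setOf_forall]
    exact isClosed_iInter fun j => isClosed_le (by fun_prop) (by fun_prop)
  refine IsCompact.of_isClosed_subset (isCompact_Icc
    (a := (fun _ => 0 : Fin n → ℝ))
    (b := fun _ => (M - 1 - Real.log (w j₀ / 2)) / (w j₀ / 2))) hcl ?_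
  rintro α ⟨⟨h0, hS⟩, h⟩
  refine ⟨h0, fun j => ?_⟩
  have h1 : α j ≤ ∑ j, α j := Finset.single_le_sum (fun i _ => h0 i) (Finset.mem_univ j)
  have h2 : w j₀ * ∑ j, α j ≤ ∑ j, w j * α j := by
    rw [Finset.mul_sum]
    exact Finset.sum_le_sum fun i _ => mul_le_mul_of_nonneg_right (hj₀ i) (h0 i)
  have h3 := Real.log_le_sub_one_of_pos (mul_pos (half_pos hc) hS)
  rw [Real.log_mul (half_pos hc).ne' hS.ne'] at h3
  refine h1.trans ?_
  rw [le_div_iff₀ (half_pos hc)]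
  linarith
end

section
/- Let n ≥ 1 and let w : Fin n → ℝ with w_j > 0 for all j. Define f(α) = Σ_j w_j·α_j - log(Σ_j α_j) on the domain D = {α ∈ ℝⁿ : α_j ≥ 0 for all j, and Σ_j α_j > 0}. Then f attains its minimum on D: there exists α* ∈ D with f(α*) ≤ f(α) for all α ∈ D. -/
open Finset

/-- The single-node exponential-model negative log-likelihood
`f α = ∑ j, w j * α j - log (∑ j, α j)` attains its minimum on the domain
`{α | ∀ j, 0 ≤ α j, and 0 < ∑ j, α j}`. -/
theorem netrate_mle_exists {n : ℕ} (hn : 1 ≤ n) (w : Fin n → ℝ) (hw : ∀ j, 0 < w j) :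
    ∃ αstar : Fin n → ℝ, ((∀ j, 0 ≤ αstar j) ∧ 0 < ∑ j, αstar j) ∧
      ∀ α : Fin n → ℝ, ((∀ j, 0 ≤ α j) ∧ 0 < ∑ j, α j) →
        (∑ j, w j * αstar j) - Real.log (∑ j, αstar j) ≤
          (∑ j, w j * α j) - Real.log (∑ j, α j) := by
  haveI : Nonempty (Fin n) := ⟨⟨0, hn⟩⟩
  obtain ⟨k, hk⟩ := Finite.exists_min w
  have hwk := hw k
  have h1 : ∑ j, (Pi.single k (w k)⁻¹ : Fin n → ℝ) j = (w k)⁻¹ := by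
    simp
  have h2 : ∑ j, w j * (Pi.single k (w k)⁻¹ : Fin n → ℝ) j = 1 := by
    rw [Finset.sum_eq_single k]
    · simp [hwk.ne']
    · intro b _ hb
      simp [hb]
    · simp
  refine ⟨Pi.single k (w k)⁻¹, ⟨?_, ?_⟩, ?_⟩
  · intro j
    by_cases hj : j = k
    · subst hj
      simp [hwk.le]
    · simp [hj]
  · rw [h1]
    positivity
  · rintro α ⟨hα, hS⟩
    rw [h1, h2, Real.log_inv]
    have h3 : w k * ∑ j, α j ≤ ∑ j, w j * α j := by
      rw [Finset.mul_sum]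
      exact Finset.sum_le_sum fun j _ => mul_le_mul_of_nonneg_right (hk j) (hα j)
    have h4 := Real.log_le_sub_one_of_pos (mul_pos hwk hS)
    rw [Real.log_mul hwk.ne' hS.ne'] at h4
    linarith
end
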